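/- arXiv:2412.16307 — 5 statements merged into one kernel-verified Lean document; each statement's English description precedes it below -/
import Mathlib

section
/- Let α, γ, σ, η be real with α, γ, σ, η > 0, γ < η, and assume 2αγ > σ²η and 2α(η − γ) > σ²η (i.e. ν₁ > 1 and ν₂ > 1). Set a₁ = (4αγ − σ²η)/(4η), a₂ = (4α(η − γ) − σ²η)/(4η), C₀ = (2α − σ²)/4, and f(y) = a₁·(cos(y/2)/sin(y/2)) − a₂·(sin(y/2)/cos(y/2)). Then C₀ > 0 and, for every y ∈ (0, π), f is differentiable at y with derivative f′(y) ≤ −C₀. -/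
theorem hasDerivAt_cot_half_sub_tan_half (a b y : ℝ)
    (hs : Real.sin (y / 2) ≠ 0) (hc : Real.cos (y / 2) ≠ 0) :
    HasDerivAt (fun y : ℝ => a * (Real.cos (y / 2) / Real.sin (y / 2))
        - b * (Real.sin (y / 2) / Real.cos (y / 2)))
      (-(a / (2 * Real.sin (y / 2) ^ 2)) - b / (2 * Real.cos (y / 2) ^ 2)) y := by
  have hhalf : HasDerivAt (fun y : ℝ => y / 2) (1 / 2) y := (hasDerivAt_id y).div_const 2
  have hsin := hhalf.sin
  have hcos := hhalf.cos
  refine (((hcos.fun_div hsin hs).const_mul a).fun_sub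
    ((hsin.fun_div hcos hc).const_mul b)).congr_deriv ?_
  have hsq := Real.sin_sq_add_cos_sq (y / 2)
  have hcot : -Real.sin (y / 2) * (1 / 2) * Real.sin (y / 2)
      - Real.cos (y / 2) * (Real.cos (y / 2) * (1 / 2)) = -(1 / 2) := by
    linear_combination (-1 / 2) * hsq
  have htan : Real.cos (y / 2) * (1 / 2) * Real.cos (y / 2)
      - Real.sin (y / 2) * (-Real.sin (y / 2) * (1 / 2)) = 1 / 2 := by
    linear_combination (1 / 2) * hsq
  rw [hcot, htan]
  field_simp

theorem half_le_div_two_mul_sq {a t : ℝ} (ha : 0 ≤ a) (ht : t ≠ 0) (ht' : t ^ 2 ≤ 1) :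
    a / 2 ≤ a / (2 * t ^ 2) :=
  div_le_div_of_nonneg_left ha (by positivity) (by linarith)

/-- Under the conditions `ν₁ > 1` and `ν₂ > 1` (i.e. `2αγ > σ²η` and `2α(η − γ) > σ²η`),
the constant `C₀ = (2α − σ²)/4` is positive and the Lamperti-transformed drift
`f(y) = a₁·cot(y/2) − a₂·tan(y/2)` is differentiable on `(0, π)` with
`f′(y) ≤ −C₀`. -/
theorem lamperti_drift_derivative_bound
    (α γ σ η : ℝ) (hα : 0 < α) (hγ : 0 < γ) (hσ : 0 < σ) (hη : 0 < η) (hγη : γ < η)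
    (h₁ : 2 * α * γ > σ^2 * η) (h₂ : 2 * α * (η - γ) > σ^2 * η)
    (a₁ a₂ C₀ : ℝ)
    (ha₁ : a₁ = (4 * α * γ - σ^2 * η) / (4 * η))
    (ha₂ : a₂ = (4 * α * (η - γ) - σ^2 * η) / (4 * η))
    (hC₀ : C₀ = (2 * α - σ^2) / 4)
    (f : ℝ → ℝ)
    (hf : ∀ y, f y = a₁ * (Real.cos (y / 2) / Real.sin (y / 2))
        - a₂ * (Real.sin (y / 2) / Real.cos (y / 2))) :
    0 < C₀ ∧
    ∀ y ∈ Set.Ioo (0:ℝ) Real.pi,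
      HasDerivAt f (-(a₁ / (2 * Real.sin (y / 2) ^ 2)) - a₂ / (2 * Real.cos (y / 2) ^ 2)) y ∧
      -(a₁ / (2 * Real.sin (y / 2) ^ 2)) - a₂ / (2 * Real.cos (y / 2) ^ 2) ≤ -C₀ := by
  have hσ2 : 0 < σ ^ 2 * η := by positivity
  have ha₁_nonneg : 0 ≤ a₁ := ha₁ ▸ div_nonneg (by linarith) (by positivity)
  have ha₂_nonneg : 0 ≤ a₂ := ha₂ ▸ div_nonneg (by linarith) (by positivity)
  have hsum : a₁ / 2 + a₂ / 2 = C₀ := by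
    rw [ha₁, ha₂, hC₀]
    field_simp
    ring
  refine ⟨?_, fun y hy => ?_⟩
  · have : 0 < (2 * α - σ ^ 2) * η := by linarith
    have := pos_of_mul_pos_left this hη.le
    rw [hC₀]
    positivity
  · obtain ⟨hy₀, hyπ⟩ := hy
    have hs : Real.sin (y / 2) ≠ 0 :=
      (Real.sin_pos_of_pos_of_lt_pi (by linarith) (by linarith)).ne'
    have hc : Real.cos (y / 2) ≠ 0 :=
      (Real.cos_pos_of_mem_Ioo ⟨by linarith, by linarith⟩).ne'
    refine ⟨?_, ?_⟩
    · rw [funext hf]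
      exact hasDerivAt_cot_half_sub_tan_half a₁ a₂ y hs hc
    · have h_sin := half_le_div_two_mul_sq ha₁_nonneg hs (Real.sin_sq_le_one _)
      have h_cos := half_le_div_two_mul_sq ha₂_nonneg hc (Real.cos_sq_le_one _)
      linarith
end

section
/- Assume α, γ, σ, η > 0, γ < η, 2αγ > σ²η and 2α(η − γ) > σ²η. Let 0 < k < 1, let y* = 2·arctan(√(a₁/a₂)) be the zero of f in (0, π), set Δ* = (min(y*, π − y*, 1))^{1/k}, and let 0 < Δ < Δ*. Define the sloping-smooth-truncated drift f_Δ : ℝ → ℝ by: f_Δ(y) = f(Δᵏ) − (1/2)Δᵏ f′(Δᵏ) − C₀(y − Δᵏ/2) for y < 0; f_Δ(y) = f(Δᵏ) + f′(Δᵏ)(y − Δᵏ) + (1/(2Δᵏ))(f′(Δᵏ) + C₀)(y − Δᵏ)² for 0 ≤ y < Δᵏ; f_Δ(y) = f(y) for Δᵏ ≤ y ≤ π − Δᵏ; f_Δ(y) = f(π − Δᵏ) + f′(π − Δᵏ)(y − π + Δᵏ) − (1/(2Δᵏ))(f′(π − Δᵏ) + C₀)(y − π + Δᵏ)² for π − Δᵏ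 < y ≤ π; f_Δ(y) = f(π − Δᵏ) + (1/2)Δᵏ f′(π − Δᵏ) − C₀(y − π + Δᵏ/2) for y > π. Then: (i) f_Δ is differentiable at every x ∈ ℝ with f_Δ′(x) ≤ −C₀; (ii) for all x, y ∈ ℝ, |f_Δ(x) − f_Δ(y)| ≤ π²·C₀·Δ^{−2k}·|x − y|; and (iii) for all x, y ∈ ℝ, (x − y)(f_Δ(x) − f_Δ(y)) ≤ −C₀·|x − y|². -/
/-- Gluing two functions at a point where their values and derivatives agree. -/
lemma hasDerivAt_ite_lt {g h : ℝ → ℝ} {g' h' c x : ℝ}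
    (hg : x ≤ c → HasDerivAt g g' x) (hh : c ≤ x → HasDerivAt h h' x)
    (hc : g c = h c) (hc' : x = c → g' = h') :
    HasDerivAt (fun y => if y < c then g y else h y) (if x < c then g' else h') x := by
  rcases lt_trichotomy x c with hx | rfl | hx
  · rw [if_pos hx]
    refine (hg hx.le).congr_of_eventuallyEq ?_
    filter_upwards [Iio_mem_nhds hx] with y hy using if_pos hy
  · rw [if_neg (lt_irrefl x)]
    have hl : HasDerivWithinAt (fun y => if y < x then g y else h y) h' (Set.Iio x) x :=
      (hc' rfl ▸ hg le_rfl).hasDerivWithinAt.congr (fun y hy => if_pos hy) (by simp [hc])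
    have hr : HasDerivWithinAt (fun y => if y < x then g y else h y) h' (Set.Ici x) x :=
      (hh le_rfl).hasDerivWithinAt.congr (fun y hy => if_neg (not_lt.mpr hy)) (by simp)
    simpa [Set.Iio_union_Ici] using hl.union hr
  · rw [if_neg hx.not_gt]
    refine (hh hx.le).congr_of_eventuallyEq ?_
    filter_upwards [Ioi_mem_nhds hx] with y hy using if_neg (not_lt.mpr (le_of_lt hy))

lemma hasDerivAt_ite_le {g h : ℝ → ℝ} {g' h' c x : ℝ}
    (hg : x ≤ c → HasDerivAt g g' x) (hh : c ≤ x → HasDerivAt h h' x)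
    (hc : g c = h c) (hc' : x = c → g' = h') :
    HasDerivAt (fun y => if y ≤ c then g y else h y) (if x ≤ c then g' else h') x := by
  convert hasDerivAt_ite_lt hg hh hc hc' using 1
  · ext y
    rcases lt_trichotomy y c with hy | rfl | hy
    · simp [hy, hy.le]
    · simp [hc]
    · simp [hy.not_gt, hy.not_ge]
  · rcases lt_trichotomy x c with hx | rfl | hx
    · simp [hx, hx.le]
    · simp [hc' rfl]
    · simp [hx.not_gt, hx.not_ge]

lemma mul_sub_le_of_hasDerivAt_le {F F' : ℝ → ℝ} {C : ℝ} (hF : ∀ x, HasDerivAt F (F' x) x)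
    (hC : ∀ x, F' x ≤ -C) (x y : ℝ) : (x - y) * (F x - F y) ≤ -C * |x - y| ^ 2 := by
  have key := image_sub_le_mul_sub_of_deriv_le (fun x => (hF x).differentiableAt)
    (fun x => (hF x).deriv.trans_le (hC x))
  rw [sq_abs]
  rcases le_total x y with h | h
  · nlinarith [key h, sub_nonneg.mpr h]
  · nlinarith [key h, sub_nonneg.mpr h]

lemma abs_sub_le_of_abs_hasDerivAt_le {F F' : ℝ → ℝ} {L : ℝ} (hF : ∀ x, HasDerivAt F (F' x) x)
    (hL : ∀ x, |F' x| ≤ L) (x y : ℝ) : |F x - F y| ≤ L * |x - y| :=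
  convex_univ.norm_image_sub_le_of_norm_hasDerivWithin_le
    (fun z _ => (hF z).hasDerivWithinAt) (fun z _ => hL z) (Set.mem_univ y) (Set.mem_univ x)

/-- Extending `f` from `[h, b - h]` to the line by quadratic pieces of width `h` and then affine
pieces of slope `-C` gives a differentiable function obeying the derivative bounds of `f`. -/
lemma exists_hasDerivAt_slopingTruncation {f f' : ℝ → ℝ} {h b C L : ℝ} (hh : 0 < h)
    (hb : h ≤ b - h) (hCL : C ≤ L) (hf : ∀ x ∈ Set.Icc h (b - h), HasDerivAt f (f' x) x)
    (hL : ∀ x ∈ Set.Icc h (b - h), -L ≤ f' x) (hC : ∀ x ∈ Set.Icc h (b - h), f' x ≤ -C) :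
    ∃ D : ℝ → ℝ, ∀ x, HasDerivAt (fun y =>
      if y < 0 then
        f h - (1/2) * h * f' h - C * (y - h / 2)
      else if y < h then
        f h + f' h * (y - h) + (1 / (2 * h)) * (f' h + C) * (y - h) ^ 2
      else if y ≤ b - h then
        f y
      else if y ≤ b then
        f (b - h) + f' (b - h) * (y - b + h)
          - (1 / (2 * h)) * (f' (b - h) + C) * (y - b + h) ^ 2
      else
        f (b - h) + (1/2) * h * f' (b - h) - C * (y - b + h / 2)) (D x) x ∧
      -L ≤ D x ∧ D x ≤ -C := by
  have hl : h ∈ Set.Icc h (b - h) := ⟨le_rfl, hb⟩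
  have hr : b - h ∈ Set.Icc h (b - h) := ⟨hb, le_rfl⟩
  refine ⟨fun x => if x < 0 then -C
    else if x < h then f' h + (f' h + C) * ((x - h) / h)
    else if x ≤ b - h then f' x
    else if x ≤ b then f' (b - h) - (f' (b - h) + C) * ((x - b + h) / h)
    else -C, fun x => ⟨?_, ?_⟩⟩
  · refine hasDerivAt_ite_lt (fun _ => ?_) (fun h0 => hasDerivAt_ite_lt (fun _ => ?_)
      (fun h1 => hasDerivAt_ite_le (fun h2 => hf x ⟨h1, h2⟩)
        (fun h3 => hasDerivAt_ite_le (fun _ => ?_) (fun _ => ?_) ?_ ?_) ?_ ?_) ?_ ?_) ?_ ?_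
    · exact ((((hasDerivAt_id x).sub_const (h / 2)).const_mul C).const_sub _).congr_deriv (by simp)
    · have hd := (hasDerivAt_id x).sub_const h
      refine (((hd.const_mul (f' h)).const_add (f h)).add
        ((hd.pow 2).const_mul (1 / (2 * h) * (f' h + C)))).congr_deriv ?_
      simp
      field_simp
    · have hd := ((hasDerivAt_id x).sub_const b).add_const h
      refine (((hd.const_mul (f' (b - h))).const_add (f (b - h))).sub
        ((hd.pow 2).const_mul (1 / (2 * h) * (f' (b - h) + C)))).congr_deriv ?_
      simp
      field_simp
    · exact (((((hasDerivAt_id x).sub_const b).add_const (h / 2)).const_mul C).const_sub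
        _).congr_deriv (by simp)
    · field_simp
      ring
    · rintro rfl
      field_simp
      ring
    · simp [hh.le]
    · rintro rfl
      simp [hh.le]
    · simp [hb]
    · rintro rfl
      simp [hb]
    · simp only [hh, if_true]
      field_simp
      ring
    · rintro rfl
      simp only [hh, if_true]
      field_simp
      ring
  · have hl1 := hL h hl
    have hl2 := hC h hl
    have hr1 := hL _ hr
    have hr2 := hC _ hr
    dsimp only
    split_ifs with h0 h1 h2 h3
    · exact ⟨by linarith, le_rfl⟩
    · have ht1 : (x - h) / h ≤ 0 := div_nonpos_of_nonpos_of_nonneg (by linarith) hh.le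
      have ht2 : -1 ≤ (x - h) / h := by rw [le_div_iff₀ hh]; linarith
      constructor <;> nlinarith
    · exact ⟨hL x ⟨not_lt.mp h1, h2⟩, hC x ⟨not_lt.mp h1, h2⟩⟩
    · have ht1 : 0 ≤ (x - b + h) / h := div_nonneg (by linarith) hh.le
      have ht2 : (x - b + h) / h ≤ 1 := by rw [div_le_iff₀ hh]; linarith
      constructor <;> nlinarith
    · exact ⟨by linarith, le_rfl⟩

lemma hasDerivAt_cot_sub_tan_half (a₁ a₂ : ℝ) {y : ℝ} (hs : Real.sin (y / 2) ≠ 0)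
    (hc : Real.cos (y / 2) ≠ 0) :
    HasDerivAt (fun y => a₁ * (Real.cos (y / 2) / Real.sin (y / 2))
        - a₂ * (Real.sin (y / 2) / Real.cos (y / 2)))
      (-(a₁ / 2 * (1 / Real.sin (y / 2) ^ 2) + a₂ / 2 * (1 / Real.cos (y / 2) ^ 2))) y := by
  have hd : HasDerivAt (fun y : ℝ => y / 2) (1 / 2) y := (hasDerivAt_id y).div_const 2
  refine (((hd.cos.div hd.sin hs).const_mul a₁).sub
    ((hd.sin.div hd.cos hc).const_mul a₂)).congr_deriv ?_
  have h1 := Real.sin_sq_add_cos_sq (y / 2)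
  field_simp
  linear_combination
    (-(a₁ * Real.cos (y / 2) ^ 2) - a₂ * Real.sin (y / 2) ^ 2) * h1

lemma one_le_one_div_sq_le {s t : ℝ} (ht : 0 < t) (hts : t ≤ s) (hs : s ≤ 1) :
    1 ≤ 1 / s ^ 2 ∧ 1 / s ^ 2 ≤ 1 / t ^ 2 := by
  have h0 : 0 < s := ht.trans_le hts
  refine ⟨?_, by gcongr⟩
  rw [le_div_iff₀ (by positivity)]
  nlinarith


/-- Properties of the sloping-smooth-truncated drift `f_Δ` of the Lamperti-transformed
Pearson SDE: `f_Δ` is everywhere differentiable with derivative at most `−C₀`, it is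
Lipschitz with constant `π²·C₀·Δ^{−2k}`, and it is one-sided Lipschitz with constant
`−C₀`. -/
theorem sloping_smooth_truncated_drift_properties
    (α γ σ η : ℝ) (hα : 0 < α) (hγ : 0 < γ) (hσ : 0 < σ) (hη : 0 < η) (hγη : γ < η)
    (h₁ : 2 * α * γ > σ^2 * η) (h₂ : 2 * α * (η - γ) > σ^2 * η)
    (a₁ a₂ C₀ : ℝ)
    (ha₁ : a₁ = (4 * α * γ - σ^2 * η) / (4 * η))
    (ha₂ : a₂ = (4 * α * (η - γ) - σ^2 * η) / (4 * η))
    (hC₀ : C₀ = (2 * α - σ^2) / 4)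
    (f : ℝ → ℝ)
    (hf : ∀ y, f y = a₁ * (Real.cos (y / 2) / Real.sin (y / 2))
        - a₂ * (Real.sin (y / 2) / Real.cos (y / 2)))
    (k : ℝ) (hk : 0 < k) (hk1 : k < 1)
    (ystar : ℝ) (hystar : ystar = 2 * Real.arctan (Real.sqrt (a₁ / a₂)))
    (Δstar : ℝ) (hΔstar : Δstar = (min (min ystar (Real.pi - ystar)) 1) ^ (1/k))
    (Δ : ℝ) (hΔpos : 0 < Δ) (hΔ : Δ < Δstar)
    (fΔ : ℝ → ℝ)
    (hfΔ : ∀ y, fΔ y =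
      if y < 0 then
        f (Δ ^ k) - (1/2) * Δ ^ k * deriv f (Δ ^ k) - C₀ * (y - Δ ^ k / 2)
      else if y < Δ ^ k then
        f (Δ ^ k) + deriv f (Δ ^ k) * (y - Δ ^ k)
          + (1 / (2 * Δ ^ k)) * (deriv f (Δ ^ k) + C₀) * (y - Δ ^ k) ^ 2
      else if y ≤ Real.pi - Δ ^ k then
        f y
      else if y ≤ Real.pi then
        f (Real.pi - Δ ^ k) + deriv f (Real.pi - Δ ^ k) * (y - Real.pi + Δ ^ k)
          - (1 / (2 * Δ ^ k)) * (deriv f (Real.pi - Δ ^ k) + C₀) * (y - Real.pi + Δ ^ k) ^ 2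
      else
        f (Real.pi - Δ ^ k) + (1/2) * Δ ^ k * deriv f (Real.pi - Δ ^ k)
          - C₀ * (y - Real.pi + Δ ^ k / 2)) :
    (∀ x : ℝ, ∃ d : ℝ, HasDerivAt fΔ d x ∧ d ≤ -C₀) ∧
    (∀ x y : ℝ, |fΔ x - fΔ y| ≤ Real.pi ^ 2 * C₀ * Δ ^ (-(2 * k)) * |x - y|) ∧
    (∀ x y : ℝ, (x - y) * (fΔ x - fΔ y) ≤ -C₀ * |x - y| ^ 2) := by
  have ha₁0 : 0 < a₁ := by
    rw [ha₁]
    have := mul_pos (pow_pos hσ 2) hη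
    exact div_pos (by linarith) (by linarith)
  have ha₂0 : 0 < a₂ := by
    rw [ha₂]
    have := mul_pos (pow_pos hσ 2) hη
    exact div_pos (by linarith) (by linarith)
  have hsum : a₁ / 2 + a₂ / 2 = C₀ := by
    rw [ha₁, ha₂, hC₀]
    field_simp
    ring
  have hΔ1 : Δ < 1 := by
    have hy0 : 0 ≤ ystar := by
      rw [hystar]
      have := Real.arctan_nonneg.mpr (Real.sqrt_nonneg (a₁ / a₂))
      linarith
    have hyπ : 0 ≤ Real.pi - ystar := by
      rw [hystar]
      linarith [Real.arctan_lt_pi_div_two (Real.sqrt (a₁ / a₂))]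
    refine hΔ.trans_le ?_
    rw [hΔstar]
    exact Real.rpow_le_one (le_min (le_min hy0 hyπ) zero_le_one) (min_le_right _ _) (by positivity)
  have hh : 0 < Δ ^ k := Real.rpow_pos_of_pos hΔpos k
  have hh1 : Δ ^ k < 1 := Real.rpow_lt_one hΔpos.le hΔ1 hk
  have hpow : Δ ^ (-(2 * k)) = 1 / (Δ ^ k) ^ 2 := by
    rw [Real.rpow_neg hΔpos.le, mul_comm, Real.rpow_mul hΔpos.le, one_div, Real.rpow_two]
  have hπ := Real.pi_gt_three
  generalize Δ ^ k = h at *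
  have hbound : ∀ y ∈ Set.Icc h (Real.pi - h),
      (h / Real.pi ≤ Real.sin (y / 2)) ∧ (h / Real.pi ≤ Real.cos (y / 2)) := by
    rintro y ⟨hy1, hy2⟩
    have jordan : ∀ z, h ≤ z → z ≤ Real.pi → h / Real.pi ≤ Real.sin (z / 2) := by
      intro z hz1 hz2
      refine le_trans ?_ (Real.mul_le_sin (by linarith : 0 ≤ z / 2) (by linarith))
      rw [div_le_iff₀ Real.pi_pos]
      field_simp
      exact hz1
    refine ⟨jordan y hy1 (by linarith), ?_⟩
    have := jordan (Real.pi - y) (by linarith) (by linarith)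
    rwa [sub_div, Real.sin_pi_div_two_sub] at this
  have ht : 0 < h / Real.pi := by positivity
  have hderiv : ∀ y ∈ Set.Icc h (Real.pi - h), HasDerivAt f
      (-(a₁ / 2 * (1 / Real.sin (y / 2) ^ 2) + a₂ / 2 * (1 / Real.cos (y / 2) ^ 2))) y := by
    intro y hy
    rw [funext hf]
    exact hasDerivAt_cot_sub_tan_half a₁ a₂ (ht.trans_le (hbound y hy).1).ne'
      (ht.trans_le (hbound y hy).2).ne'
  have hL : Real.pi ^ 2 * C₀ * Δ ^ (-(2 * k)) = C₀ * (1 / (h / Real.pi) ^ 2) := by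
    rw [hpow]
    field_simp
  have hC₀0 : 0 < C₀ := by linarith
  have hCL : C₀ ≤ Real.pi ^ 2 * C₀ * Δ ^ (-(2 * k)) := by
    rw [hL]
    refine le_mul_of_one_le_right hC₀0.le ?_
    obtain ⟨h1, h2⟩ := one_le_one_div_sq_le ht (hbound h ⟨le_rfl, by linarith⟩).1
      (Real.sin_le_one _)
    exact h1.trans h2
  obtain ⟨D, hD⟩ := exists_hasDerivAt_slopingTruncation (f := f) (f' := deriv f) hh
    (by linarith : h ≤ Real.pi - h) hCL
    (fun y hy => (hderiv y hy).differentiableAt.hasDerivAt)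
    (fun y hy => by
      rw [(hderiv y hy).deriv, hL, ← hsum]
      obtain ⟨_, h1⟩ := one_le_one_div_sq_le ht (hbound y hy).1 (Real.sin_le_one _)
      obtain ⟨_, h2⟩ := one_le_one_div_sq_le ht (hbound y hy).2 (Real.cos_le_one _)
      nlinarith)
    (fun y hy => by
      rw [(hderiv y hy).deriv, ← hsum]
      obtain ⟨h1, _⟩ := one_le_one_div_sq_le ht (hbound y hy).1 (Real.sin_le_one _)
      obtain ⟨h2, _⟩ := one_le_one_div_sq_le ht (hbound y hy).2 (Real.cos_le_one _)
      nlinarith)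
  rw [← funext hfΔ] at hD
  refine ⟨fun x => ⟨D x, (hD x).1, (hD x).2.2⟩,
    abs_sub_le_of_abs_hasDerivAt_le (fun x => (hD x).1) fun x => abs_le.mpr ⟨(hD x).2.1, ?_⟩,
    mul_sub_le_of_hasDerivAt_le (fun x => (hD x).1) fun x => (hD x).2.2⟩
  linarith [(hD x).2.2]
end

section
/- Let λ ∈ ℝ, φ₁ > 0, φ₂ < 0, c₀ > 0 with φ₁ + φ₂c₀ > 0, and let s : ℝ → ℝ be continuous. Define c(t) = φ₁c₀ / ( (φ₁ + φ₂c₀)·exp(λφ₁·∫₀ᵗ s(r) dr) − φ₂c₀ ). Then the denominator is strictly positive for every t, c(0) = c₀, and for every t ∈ ℝ the function c is differentiable at t with derivative c′(t) = −λ·(φ₁ + φ₂·c(t))·s(t)·c(t); that is, c solves the calcite reaction ODE ∂ₜc = −λ·φ(c)·s·c with initial value c₀. -/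
/-- The explicit formula `c(t) = φ₁c₀/((φ₁ + φ₂c₀)·e^{lam·φ₁∫₀ᵗ s} − φ₂c₀)` has a strictly
positive denominator, satisfies `c(0) = c₀`, and solves the calcite reaction ODE
`c′(t) = −lam·(φ₁ + φ₂c(t))·s(t)·c(t)`.  (Here `lam` denotes the reaction rate `λ`.) -/
theorem calcite_explicit_solution
    (lam φ₁ φ₂ c₀ : ℝ) (hφ₁ : 0 < φ₁) (hφ₂ : φ₂ < 0) (hc₀ : 0 < c₀)
    (hφ : 0 < φ₁ + φ₂ * c₀)
    (s : ℝ → ℝ) (hs : Continuous s)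
    (c : ℝ → ℝ)
    (hc : ∀ t, c t = φ₁ * c₀ /
      ((φ₁ + φ₂ * c₀) * Real.exp (lam * φ₁ * ∫ r in (0:ℝ)..t, s r) - φ₂ * c₀)) :
    (∀ t : ℝ, 0 < (φ₁ + φ₂ * c₀) * Real.exp (lam * φ₁ * ∫ r in (0:ℝ)..t, s r) - φ₂ * c₀) ∧
    c 0 = c₀ ∧
    ∀ t : ℝ, HasDerivAt c (-(lam * (φ₁ + φ₂ * c t) * s t * c t)) t := by
  have hD : ∀ t : ℝ,
      0 < (φ₁ + φ₂ * c₀) * Real.exp (lam * φ₁ * ∫ r in (0:ℝ)..t, s r) - φ₂ * c₀ := by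
    intro t
    have hexp := mul_pos hφ (Real.exp_pos (lam * φ₁ * ∫ r in (0:ℝ)..t, s r))
    have hneg := mul_neg_of_neg_of_pos hφ₂ hc₀
    linarith
  refine ⟨hD, ?_, fun t => ?_⟩
  · rw [hc, intervalIntegral.integral_same, mul_zero, Real.exp_zero, mul_one,
      add_sub_cancel_right, mul_div_cancel_left₀ _ hφ₁.ne']
  · have hderiv := (hasDerivAt_const t (φ₁ * c₀)).fun_div
      ((((hs.integral_hasStrictDerivAt 0 t).hasDerivAt.const_mul (lam * φ₁)).exp.const_mul
        (φ₁ + φ₂ * c₀)).sub_const (φ₂ * c₀)) (hD t).ne'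
    rw [funext hc]
    refine hderiv.congr_deriv ?_
    have hne := (hD t).ne'
    beta_reduce
    generalize Real.exp (lam * φ₁ * ∫ r in (0:ℝ)..t, s r) = E at hne ⊢
    field_simp
    ring
end

section
/- Let φ₁ > 0, φ₂ < 0 and let c̄₀ ≥ 0 satisfy c̄₀ < −(4/5)·(φ₁/φ₂). Then for all c₁, c₂, c₃ ∈ [0, c̄₀], writing φ(c) = φ₁ + φ₂c, one has φ(c₂) > 0 and both 4φ(c₂) − (φ(c₃) − φ(c₁)) ≥ 4φ₁ + 5φ₂c̄₀ > 0 and 4φ(c₂) + (φ(c₃) − φ(c₁)) ≥ 4φ₁ + 5φ₂c̄₀ > 0; equivalently |φ(c₃) − φ(c₁)| < 4φ(c₂). Hence the advection coefficients 1 ± (φ(c₃) − φ(c₁))/(4φ(c₂)) of the finite-difference scheme are strictly positive. -/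
/-- Under condition (34), `c̄₀ < (4/5)(φ₁/|φ₂|)`, the advection coefficients
`1 ± (φ(c₃) − φ(c₁))/(4φ(c₂))` of the finite-difference scheme are strictly positive,
for calcite values `c₁, c₂, c₃ ∈ [0, c̄₀]` and porosity `φ(c) = φ₁ + φ₂c`. -/
theorem scheme_advection_coefficients_positive
    (φ₁ φ₂ cbar₀ : ℝ) (hφ₁ : 0 < φ₁) (hφ₂ : φ₂ < 0)
    (hcbar₀ : 0 ≤ cbar₀) (hcond : cbar₀ < -(4/5) * (φ₁ / φ₂))
    (φ : ℝ → ℝ) (hφ : ∀ c, φ c = φ₁ + φ₂ * c) :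
    ∀ c₁ ∈ Set.Icc (0:ℝ) cbar₀, ∀ c₂ ∈ Set.Icc (0:ℝ) cbar₀, ∀ c₃ ∈ Set.Icc (0:ℝ) cbar₀,
      0 < φ c₂ ∧
      4 * φ c₂ - (φ c₃ - φ c₁) ≥ 4 * φ₁ + 5 * φ₂ * cbar₀ ∧
      4 * φ c₂ + (φ c₃ - φ c₁) ≥ 4 * φ₁ + 5 * φ₂ * cbar₀ ∧
      0 < 4 * φ₁ + 5 * φ₂ * cbar₀ ∧
      |φ c₃ - φ c₁| < 4 * φ c₂ ∧
      0 < 1 - (φ c₃ - φ c₁) / (4 * φ c₂) ∧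
      0 < 1 + (φ c₃ - φ c₁) / (4 * φ c₂) := by
  have hpos : 0 < 4 * φ₁ + 5 * φ₂ * cbar₀ := by
    have h := mul_lt_mul_of_neg_left hcond hφ₂
    have hdiv : φ₂ * (-(4/5) * (φ₁ / φ₂)) = -(4/5) * φ₁ := by
      field_simp [hφ₂.ne]
    linarith
  have hbounds : ∀ c ∈ Set.Icc (0:ℝ) cbar₀, φ₂ * cbar₀ ≤ φ₂ * c ∧ φ₂ * c ≤ 0 := fun c hc =>
    ⟨mul_le_mul_of_nonpos_left hc.2 hφ₂.le, mul_nonpos_of_nonpos_of_nonneg hφ₂.le hc.1⟩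
  intro c₁ hc₁ c₂ hc₂ c₃ hc₃
  obtain ⟨hl₁, hu₁⟩ := hbounds c₁ hc₁
  obtain ⟨hl₂, hu₂⟩ := hbounds c₂ hc₂
  obtain ⟨hl₃, hu₃⟩ := hbounds c₃ hc₃
  have hsub : 4 * φ c₂ - (φ c₃ - φ c₁) ≥ 4 * φ₁ + 5 * φ₂ * cbar₀ := by
    simp only [hφ]
    linarith
  have hadd : 4 * φ c₂ + (φ c₃ - φ c₁) ≥ 4 * φ₁ + 5 * φ₂ * cbar₀ := by
    simp only [hφ]
    linarith
  have hφc₂ : 0 < φ c₂ := by linarith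
  have habs : |φ c₃ - φ c₁| < 4 * φ c₂ := abs_lt.mpr ⟨by linarith, by linarith⟩
  have hquot : |(φ c₃ - φ c₁) / (4 * φ c₂)| < 1 := by
    have hden : 0 < 4 * φ c₂ := by linarith
    rwa [abs_div, abs_of_pos hden, div_lt_one hden]
  obtain ⟨hlower, hupper⟩ := abs_lt.mp hquot
  exact ⟨hφc₂, hsub, hadd, hpos, habs, by linarith, by linarith⟩
end

section
/- Fix an integer M ≥ 2, reals φ₁ > 0, φ₂ < 0, λ > 0, Δx > 0, η̃ > 0, c̄₀ with 0 < c̄₀ < −(4/5)(φ₁/φ₂), s̄₀ ∈ [0, η̃), and Δt with 0 < Δt ≤ Δx²/(2 + λc̄₀Δx²(1 − φ₂η̃)); set Δ̄ = Δt/Δx² and φ(c) = φ₁ + φ₂c. Let ψ̃ : ℕ → ℝ satisfy ψ̃ⁿ ∈ [0, η̃) for all n. Let s, c : ℕ → {0, 1, …, M} → ℝ be defined by: initial data s⁰₀ = ψ̃⁰, s⁰ₘ = s̄₀ for 1 ≤ m ≤ M, c⁰ₘ = c̄₀ for all m; and for every n ≥ 0: cₘⁿ⁺¹ = cₘⁿ·exp(−λΔt·sₘⁿ·φ(cₘⁿ))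 for all m; s₀ⁿ⁺¹ = ψ̃ⁿ⁺¹; for 1 ≤ m ≤ M − 1, sₘⁿ⁺¹ = Δ̄(1 + bₘⁿ)s_{m+1}ⁿ + Δ̄(1 − bₘⁿ)s_{m−1}ⁿ + (1 − 2Δ̄ − λΔt·cₘⁿ(1 − φ₂sₘⁿ))sₘⁿ, where bₘⁿ = (φ(c_{m+1}ⁿ) − φ(c_{m−1}ⁿ))/(4φ(cₘⁿ)); and s_Mⁿ⁺¹ = 2Δ̄·s_{M−1}ⁿ + (1 − 2Δ̄ − λΔt·c_Mⁿ(1 − φ₂s_Mⁿ))s_Mⁿ. Then for every n ≥ 0 and every m ∈ {0, …, M}: 0 ≤ sₘⁿ < η̃ and 0 ≤ cₘⁿ ≤ c̄₀. -/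
/-- A combination with nonnegative weights, one of them positive, of total mass at most one
preserves the interval `[0, η)`. -/
theorem weighted_sum_mem_Ico {η a b w x y z : ℝ} (ha : 0 < a) (hb : 0 ≤ b) (hw : 0 ≤ w)
    (hsum : a + b + w ≤ 1) (hx : x ∈ Set.Ico 0 η) (hy : y ∈ Set.Ico 0 η)
    (hz : z ∈ Set.Ico 0 η) : a * x + b * y + w * z ∈ Set.Ico 0 η := by
  obtain ⟨hx0, hxη⟩ := hx
  obtain ⟨hy0, hyη⟩ := hy
  obtain ⟨hz0, hzη⟩ := hz
  refine ⟨by positivity, ?_⟩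
  have h1 : a * x < a * η := mul_lt_mul_of_pos_left hxη ha
  have h2 : b * y ≤ b * η := mul_le_mul_of_nonneg_left hyη.le hb
  have h3 : w * z ≤ w * η := mul_le_mul_of_nonneg_left hzη.le hw
  have h4 : (a + b + w) * η ≤ 1 * η :=
    mul_le_mul_of_nonneg_right hsum (hx0.trans hxη.le)
  linarith

/-- If `p`, `q`, `r` lie in `(d, 5 * d]`, then `|(p - q) / (4 * r)| < 1`. -/
theorem abs_sub_div_four_mul_lt_one {d p q r : ℝ} (hd : 0 < d) (hp : p ∈ Set.Ioc d (5 * d))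
    (hq : q ∈ Set.Ioc d (5 * d)) (hr : r ∈ Set.Ioc d (5 * d)) :
    |(p - q) / (4 * r)| < 1 := by
  obtain ⟨hp1, hp2⟩ := hp
  obtain ⟨hq1, hq2⟩ := hq
  have hr1 := hr.1
  have hr4 : 0 < 4 * r := by linarith
  rw [abs_div, abs_of_pos hr4, div_lt_one hr4, abs_lt]
  constructor <;> linarith

/-- Positivity and boundedness of the FTCS scheme for the sulphation system: under
conditions (34)–(35) on the initial calcite density and the time step, the discrete
solution satisfies `0 ≤ sₘⁿ < η̃` and `0 ≤ cₘⁿ ≤ c̄₀` at every node.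
(`lam` denotes the reaction rate `λ`.) -/
theorem ftcs_sulphation_scheme_bounds
    (M : ℕ) (hM : 2 ≤ M)
    (φ₁ φ₂ lam Δx ηtilde cbar₀ sbar₀ Δt : ℝ)
    (hφ₁ : 0 < φ₁) (hφ₂ : φ₂ < 0) (hlam : 0 < lam) (hΔx : 0 < Δx) (hηtilde : 0 < ηtilde)
    (hcbar₀pos : 0 < cbar₀) (hcbar₀ : cbar₀ < -(4/5) * (φ₁ / φ₂))
    (hsbar₀ : sbar₀ ∈ Set.Ico (0:ℝ) ηtilde)
    (hΔtpos : 0 < Δt)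
    (hΔt : Δt ≤ Δx^2 / (2 + lam * cbar₀ * Δx^2 * (1 - φ₂ * ηtilde)))
    (Δbar : ℝ) (hΔbar : Δbar = Δt / Δx^2)
    (φ : ℝ → ℝ) (hφ : ∀ x, φ x = φ₁ + φ₂ * x)
    (ψ : ℕ → ℝ) (hψ : ∀ n, ψ n ∈ Set.Ico (0:ℝ) ηtilde)
    (s c : ℕ → ℕ → ℝ)
    (hs00 : s 0 0 = ψ 0)
    (hs0 : ∀ m, 1 ≤ m → m ≤ M → s 0 m = sbar₀)
    (hc0 : ∀ m ≤ M, c 0 m = cbar₀)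
    (hcrec : ∀ n, ∀ m ≤ M,
      c (n+1) m = c n m * Real.exp (-(lam * Δt * s n m * φ (c n m))))
    (hsleft : ∀ n, s (n+1) 0 = ψ (n+1))
    (hsrec : ∀ n, ∀ m, 1 ≤ m → m ≤ M - 1 →
      s (n+1) m
        = Δbar * (1 + (φ (c n (m+1)) - φ (c n (m-1))) / (4 * φ (c n m))) * s n (m+1)
          + Δbar * (1 - (φ (c n (m+1)) - φ (c n (m-1))) / (4 * φ (c n m))) * s n (m-1)
          + (1 - 2 * Δbar - lam * Δt * c n m * (1 - φ₂ * s n m)) * s n m)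
    (hsright : ∀ n,
      s (n+1) M
        = 2 * Δbar * s n (M-1)
          + (1 - 2 * Δbar - lam * Δt * c n M * (1 - φ₂ * s n M)) * s n M) :
    ∀ n, ∀ m ≤ M,
      0 ≤ s n m ∧ s n m < ηtilde ∧ 0 ≤ c n m ∧ c n m ≤ cbar₀ := by
  have hΔx2 : 0 < Δx ^ 2 := by positivity
  have hηφ : 0 < 1 - φ₂ * ηtilde := by nlinarith
  have hΔbarpos : 0 < Δbar := by rw [hΔbar]; positivity
  have hCFL : 2 * Δbar + lam * Δt * (cbar₀ * (1 - φ₂ * ηtilde)) ≤ 1 := by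
    rw [le_div_iff₀ (by positivity)] at hΔt
    have hmul : Δbar * Δx ^ 2 = Δt := by rw [hΔbar]; field_simp
    refine le_of_mul_le_mul_right ?_ hΔx2
    linear_combination hΔt + 2 * hmul
  have hcφ : -(4 / 5) * φ₁ < φ₂ * cbar₀ := by
    rw [← mul_div_assoc, lt_div_iff_of_neg hφ₂] at hcbar₀
    linarith
  have hφmem : ∀ x, 0 ≤ x → x ≤ cbar₀ → φ x ∈ Set.Ioc (φ₁ / 5) (5 * (φ₁ / 5)) := by
    intro x hx0 hx
    rw [hφ]
    have := mul_le_mul_of_nonpos_left hx hφ₂.le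
    have := mul_nonpos_of_nonpos_of_nonneg hφ₂.le hx0
    constructor <;> linarith
  have hreact : ∀ u x, 0 ≤ u → u < ηtilde → 0 ≤ x → x ≤ cbar₀ →
      0 ≤ lam * Δt * x * (1 - φ₂ * u) ∧
        0 ≤ 1 - 2 * Δbar - lam * Δt * x * (1 - φ₂ * u) := by
    intro u x hu0 hu hx0 hx
    have h1 : 0 ≤ 1 - φ₂ * u := by
      have := mul_nonpos_of_nonpos_of_nonneg hφ₂.le hu0
      linarith
    have h2 : 1 - φ₂ * u ≤ 1 - φ₂ * ηtilde := by
      have := mul_le_mul_of_nonpos_left hu.le hφ₂.le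
      linarith
    have h3 : x * (1 - φ₂ * u) ≤ cbar₀ * (1 - φ₂ * ηtilde) :=
      mul_le_mul hx h2 h1 hcbar₀pos.le
    have h4 := mul_le_mul_of_nonneg_left h3 (mul_pos hlam hΔtpos).le
    refine ⟨by positivity, ?_⟩
    rw [mul_assoc (lam * Δt)]
    linarith
  intro n
  induction n with
  | zero =>
    intro m hm
    have hs : s 0 m ∈ Set.Ico 0 ηtilde := by
      rcases Nat.eq_zero_or_pos m with rfl | hm0
      · rw [hs00]; exact hψ 0
      · rw [hs0 m hm0 hm]; exact hsbar₀
    rw [hc0 m hm]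
    exact ⟨hs.1, hs.2, hcbar₀pos.le, le_rfl⟩
  | succ n ih =>
    have ihs : ∀ m ≤ M, s n m ∈ Set.Ico 0 ηtilde := fun m hm => ⟨(ih m hm).1, (ih m hm).2.1⟩
    have ihφ : ∀ m ≤ M, φ (c n m) ∈ Set.Ioc (φ₁ / 5) (5 * (φ₁ / 5)) :=
      fun m hm => hφmem _ (ih m hm).2.2.1 (ih m hm).2.2.2
    intro m hm
    obtain ⟨hsm0, hsm, hcm0, hcm⟩ := ih m hm
    obtain ⟨hr0, hw⟩ := hreact _ _ hsm0 hsm hcm0 hcm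
    have hs : s (n + 1) m ∈ Set.Ico 0 ηtilde := by
      rcases Nat.eq_zero_or_pos m with rfl | hm0
      · rw [hsleft]; exact hψ (n + 1)
      rcases hm.eq_or_lt with rfl | hmM
      · rw [hsright]
        have := weighted_sum_mem_Ico (a := 2 * Δbar) (b := 0) (by positivity) le_rfl hw
          (by linarith) (ihs (m - 1) (by lia)) (ihs m le_rfl) (ihs m le_rfl)
        simpa using this
      · rw [hsrec n m hm0 (by lia)]
        have hb := abs_lt.1 (abs_sub_div_four_mul_lt_one (by positivity)
          (ihφ (m + 1) hmM) (ihφ (m - 1) (by lia)) (ihφ m hm))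
        exact weighted_sum_mem_Ico (mul_pos hΔbarpos (by linarith [hb.1]))
          (mul_nonneg hΔbarpos.le (by linarith [hb.2])) hw (by linarith)
          (ihs (m + 1) hmM) (ihs (m - 1) (by lia)) (ihs m hm)
    have hφpos : 0 < φ (c n m) := (by positivity : 0 < φ₁ / 5).trans (ihφ m hm).1
    have hexp : Real.exp (-(lam * Δt * s n m * φ (c n m))) ≤ 1 :=
      Real.exp_le_one_iff.2 (neg_nonpos.2 (by positivity))
    rw [hcrec n m hm]
    exact ⟨hs.1, hs.2, by positivity, (mul_le_of_le_one_right hcm0 hexp).trans hcm⟩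
end
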